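/- Let O be an L-theory, ψ an L-sentence, and V = {β_1, …, β_m} a finite uniform interpolant of O ∪ {¬ψ} for S_A; let H0 = ¬β_1 ∨ … ∨ ¬β_m (with H0 = ⊥ if V is empty). Then O ∪ {H0} ⊨ ψ, and for every S_A-sentence H' with O ∪ {H'} ⊨ ψ, it holds that O ∪ {H'} ⊨ H0. (The negation of a uniform interpolant of the background theory extended by the negated observation is a semantically minimal explanation of the observation over the abducible signature.) -/

import Mathlib

open FirstOrder Language

namespace Abduction

variable {L' L : FirstOrder.Language}

/-- An `L`-sentence is an `S_A`-sentence (w.r.t. the language homomorphism `ι`)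
if it is the image under `ι` of some `L'`-sentence. -/
def IsSA (ι : L' →ᴸ L) (φ : L.Sentence) : Prop :=
  ∃ β : L'.Sentence, ι.onSentence β = φ

/-- `V` is a uniform interpolant of `O` for the abducible signature given by `ι`:
`V` is an `S_A`-theory and for every `S_A`-sentence `β`, `O ⊨ β` iff `V ⊨ β`. -/
def IsUniformInterpolant (ι : L' →ᴸ L) (O V : L.Theory) : Prop :=
  (∀ β ∈ V, IsSA ι β) ∧ ∀ φ : L.Sentence, IsSA ι φ → ((O ⊨ᵇ φ) ↔ (V ⊨ᵇ φ))

/-- Finite disjunction `b 0 ∨ ... ∨ b (n-1)`; the empty disjunction is `⊥`. -/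
def disj {L : FirstOrder.Language} : {n : ℕ} → (Fin n → L.Sentence) → L.Sentence
  | 0, _ => ⊥
  | _ + 1, b => b 0 ⊔ disj fun i => b i.succ

/-- Disjunction of a list of sentences; the empty disjunction is `⊥`. -/
def ldisj {L : FirstOrder.Language} : List L.Sentence → L.Sentence
  | [] => ⊥
  | φ :: rest => φ ⊔ ldisj rest

open Classical in
/-- Single-pass redundancy elimination: go through the enumeration, removing an axiom
if it is entailed by `O` together with the remaining axioms. -/
noncomputable def spre (O : L.Theory) : List L.Sentence → L.Theory → L.Theory
  | [], R => R
  | β :: rest, R => spre O rest (if (O ∪ (R \ {β})) ⊨ᵇ β then R \ {β} else R)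


theorem IsSA.not {ι : L' →ᴸ L} {φ : L.Sentence} (h : IsSA ι φ) : IsSA ι φ.not := by
  obtain ⟨β, rfl⟩ := h
  exact ⟨β.not, rfl⟩

theorem realize_disj (M : Type*) [L.Structure M] {n : ℕ} (b : Fin n → L.Sentence) :
    M ⊨ disj b ↔ ∃ i, M ⊨ b i := by
  induction n with
  | zero => simp [disj, Sentence.Realize]
  | succ n ih =>
    rw [Fin.exists_fin_succ, ← ih]
    exact Formula.realize_sup

theorem models_union_singleton_iff.{u, v} {L : FirstOrder.Language.{u, v}} {T : L.Theory}
    {φ χ : L.Sentence} :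
    ((T ∪ {φ}) ⊨ᵇ χ) ↔ ∀ M : Theory.ModelType.{u, v, max u v} T, M ⊨ φ → M ⊨ χ := by
  rw [Theory.models_sentence_iff]
  constructor
  · intro h M hφ
    have : M ⊨ T ∪ {φ} := M.is_model.union (by simpa [Theory.model_iff] using hφ)
    exact h (Theory.ModelType.of _ M)
  · intro h M
    have : M ⊨ T := M.is_model.mono Set.subset_union_left
    exact h (Theory.ModelType.of T M)
      (M.is_model.realize_of_mem φ (Set.mem_union_right _ rfl))

/-- The negation of a uniform interpolant of `O ∪ {¬ψ}` is a semantically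
minimal explanation of `ψ` over the abducible signature. -/
theorem negated_UI_is_minimal_explanation
    (ι : L' →ᴸ L) (O : L.Theory) (ψ : L.Sentence)
    (m : ℕ) (b : Fin m → L.Sentence) (hinj : Function.Injective b)
    (hUI : IsUniformInterpolant ι (O ∪ {ψ.not}) (Set.range b)) :
    ((O ∪ {disj fun i => (b i).not}) ⊨ᵇ ψ) ∧
      ∀ H' : L.Sentence, IsSA ι H' → ((O ∪ {H'}) ⊨ᵇ ψ) →
        (O ∪ {H'}) ⊨ᵇ disj fun i => (b i).not := by
  obtain ⟨hSA, hV⟩ := hUI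
  simp only [models_union_singleton_iff, realize_disj, Sentence.realize_not]
  refine ⟨fun M ⟨i, hi⟩ => ?_, fun H' hH' hψ M hM => ?_⟩
  · have hb := (hV (b i) (hSA _ ⟨i, rfl⟩)).2 (Theory.models_sentence_of_mem ⟨i, rfl⟩)
    by_contra hM
    exact hi (models_union_singleton_iff.1 hb M ((Sentence.realize_not M).2 hM))
  · have hnot : (O ∪ {ψ.not}) ⊨ᵇ H'.not := models_union_singleton_iff.2 fun N hN =>
      (Sentence.realize_not N).2 fun h => (Sentence.realize_not N).1 hN (hψ N h)
    by_contra! hM'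
    have : M ⊨ Set.range b := ⟨by rintro _ ⟨i, rfl⟩; exact hM' i⟩
    exact (Sentence.realize_not M).1 (((hV _ hH'.not).1 hnot).realize_sentence M) hM

end Abduction
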